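/- Let k ≥ 1 and r ≥ 0 be integers, let ξ be a real number and let v be a real number with |v| ≤ 1. Then A_r(k;v,ξ) ≥ 0. -/

import Mathlib

open Finset

/-- `bmvA k r v ξ = A_r(k; v, ξ)`, the double series
`Σ_m Σ_{j=0}^k C(k,j) · 2^{k+r−1} · ((m−j+2)/2)_{k+r−1} / (m+1)_{k+2r−1} · v^j · ξ^m/m!`. -/
noncomputable def bmvA (k r : ℕ) (v ξ : ℝ) : ℝ :=
  ∑' m : ℕ, ∑ j ∈ Finset.range (k + 1),
    (Nat.choose k j : ℝ) * 2 ^ (k + r - 1) *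
      (ascPochhammer ℝ (k + r - 1)).eval (((m : ℝ) - j + 2) / 2) /
      (ascPochhammer ℝ (k + 2 * r - 1)).eval ((m : ℝ) + 1) *
      v ^ j * ξ ^ m / (Nat.factorial m : ℝ)

open Polynomial in
theorem coeff_one_add_mul_one_sub_recurrence {N a b : ℕ} (h : a + b + 2 = 2 * N) :
    ((a : ℝ) + 1) * ((1 + X) ^ a * (1 - X) ^ (b + 2) : ℝ[X]).coeff N +
      (b + 1) * ((1 + X) ^ (a + 2) * (1 - X) ^ b : ℝ[X]).coeff N = 0 := by
  obtain ⟨n, rfl⟩ : ∃ n, N = n + 1 := ⟨N - 1, by omega⟩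
  set w : ℝ[X] := (1 + X) ^ (a + 1) * (1 - X) ^ (b + 1) with hw
  have hn : (a : ℝ) + b = 2 * n := by
    have : a + b = 2 * n := by omega
    exact_mod_cast this
  have hC : (C (a : ℝ) + C (b : ℝ) : ℝ[X]) = 2 * C (n : ℝ) := by
    rw [← C_add, hn, C_mul]; rfl
  have key : C ((a : ℝ) + 1) * ((1 + X) ^ a * (1 - X) ^ (b + 2)) +
      C ((b : ℝ) + 1) * ((1 + X) ^ (a + 2) * (1 - X) ^ b) =
      C 2 * (C ((n : ℝ) + 1) * w - X * derivative w) := by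
    have hd : derivative w = (1 + X) ^ a * (1 - X) ^ b *
        ((C (a : ℝ) + 1) * (1 - X) - (C (b : ℝ) + 1) * (1 + X)) := by
      rw [hw, derivative_mul, derivative_pow_succ, derivative_pow_succ]
      simp only [derivative_add, derivative_sub, derivative_one, derivative_X, C_add, C_1]
      ring
    have hb : (C (b : ℝ) : ℝ[X]) = 2 * C (n : ℝ) - C (a : ℝ) := by rw [← hC]; ring
    have h2 : (C 2 : ℝ[X]) = 2 := rfl
    rw [hd, hw]
    simp only [C_add, C_1, hb, h2]
    ring
  have := congrArg (fun p : ℝ[X] => p.coeff (n + 1)) key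
  simp only [coeff_add, coeff_sub, coeff_C_mul, coeff_X_mul, coeff_derivative] at this
  rw [this]
  ring

theorem factorial_mul_centralBinom_eq_prod (N : ℕ) :
    (N.factorial : ℝ) * N.centralBinom = 2 ^ N * ∏ i ∈ range N, (2 * (i : ℝ) + 1) := by
  induction N with
  | zero => simp
  | succ n ih =>
    have h : ((n : ℝ) + 1) * (n + 1).centralBinom = 2 * (2 * n + 1) * n.centralBinom := by
      exact_mod_cast n.succ_mul_centralBinom_succ
    rw [prod_range_succ, Nat.factorial_succ]
    push_cast
    linear_combination (n.factorial : ℝ) * h + 2 * (2 * (n : ℝ) + 1) * ih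

open Polynomial in
theorem factorial_mul_coeff_one_add_mul_one_sub (N : ℕ) : ∀ a b : ℕ, a + b = 2 * N →
    (N.factorial : ℝ) * ((1 + X) ^ a * (1 - X) ^ b : ℝ[X]).coeff N =
      2 ^ N * ∏ i ∈ range N, ((a : ℝ) - (2 * i + 1))
  | 0, b, h => by
    have hb : b = 2 * N := by omega
    have he : ((1 - X) ^ b : ℝ[X]) = (X + C (-1)) ^ (2 * N) := by
      rw [hb, pow_mul, pow_mul, C_neg, C_1]; congr 1; ring
    have hp : ∏ i ∈ range N, (((0 : ℕ) : ℝ) - (2 * i + 1)) =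
        (-1) ^ N * ∏ i ∈ range N, (2 * (i : ℝ) + 1) := by
      simp [zero_sub, Finset.prod_neg, -neg_add_rev]
    rw [pow_zero, one_mul, he, coeff_X_add_C_pow, hp, ← Nat.centralBinom_eq_two_mul_choose,
      show 2 * N - N = N by omega]
    linear_combination (-1) ^ N * factorial_mul_centralBinom_eq_prod N
  | 1, b, h => by
    obtain ⟨n, rfl⟩ : ∃ n, N = n + 1 := ⟨N - 1, by omega⟩
    have hb : b = 2 * n + 1 := by omega
    have he : ((1 + X) ^ 1 * (1 - X) ^ b : ℝ[X]) =
        -((X + C (-1)) ^ (2 * n + 1) + X * (X + C (-1)) ^ (2 * n + 1)) := by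
      rw [hb, show (1 - X : ℝ[X]) = -(X + C (-1)) by simp [sub_eq_neg_add, add_comm], Odd.neg_pow ⟨n, rfl⟩]; ring
    have hc : (2 * n + 1).choose (n + 1) = (2 * n + 1).choose n :=
      Nat.choose_symm_of_eq_add (by omega)
    rw [he, prod_range_succ']
    simp only [coeff_neg, coeff_add, coeff_X_mul, coeff_X_add_C_pow, hc,
      show 2 * n + 1 - (n + 1) = n by omega, show 2 * n + 1 - n = n + 1 by omega]
    push_cast
    ring
  | a + 2, b, h => by
    have ih := factorial_mul_coeff_one_add_mul_one_sub N a (b + 2) (by omega)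
    have hr := coeff_one_add_mul_one_sub_recurrence (N := N) (a := a) (b := b) (by omega)
    obtain ⟨n, rfl⟩ : ∃ n, N = n + 1 := ⟨N - 1, by omega⟩
    have hn : (a : ℝ) + b = 2 * n := by
      have : a + b = 2 * n := by omega
      exact_mod_cast this
    rw [prod_range_succ] at ih
    rw [prod_range_succ']
    have hp : ∏ i ∈ range n, (((a + 2 : ℕ) : ℝ) - (2 * ((i + 1 : ℕ) : ℝ) + 1)) =
        ∏ i ∈ range n, ((a : ℝ) - (2 * i + 1)) :=
      prod_congr rfl fun i _ => by push_cast; ring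
    rw [hp]
    have hb : (b : ℝ) + 1 ≠ 0 := by positivity
    apply mul_left_cancel₀ hb
    push_cast
    linear_combination ((n + 1).factorial : ℝ) * hr - ((a : ℝ) + 1) * ih -
      (2 ^ (n + 1) * (∏ i ∈ range n, ((a : ℝ) - (2 * i + 1))) * (a + 1)) * hn

theorem prod_erase_range_sub (l b : ℕ) :
    ∏ j ∈ (range (l + 1 + b)).erase l, ((j : ℝ) - l) =
      (-1) ^ l * l.factorial * b.factorial := by
  induction b with
  | zero =>
    have : (range (l + 1)).erase l = range l := by
      rw [range_add_one, erase_insert notMem_range_self]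
    rw [add_zero, this]
    clear this
    rw [← prod_range_reflect, Nat.factorial_zero, Nat.cast_one, mul_one,
      ← Finset.prod_range_add_one_eq_factorial, Nat.cast_prod, ← card_range l,
      ← prod_const, card_range, ← prod_mul_distrib]
    refine prod_congr rfl fun i hi => ?_
    have hi := mem_range.1 hi
    rw [Nat.sub_sub, Nat.cast_sub (by omega)]
    push_cast; ring
  | succ b ih =>
    rw [← add_assoc, range_add_one, erase_insert_of_ne (by omega), prod_insert (by simp), ih,
      Nat.factorial_succ]
    push_cast; ring

open Polynomial Lagrange in
/-- Partial fractions of `p / nodal s v`, the quotient being `0` or `1`. -/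
theorem eval_eq_nodal_mul_of_monic {s : Finset ℕ} {v : ℕ → ℝ} {p : ℝ[X]} {x : ℝ}
    (hv : Set.InjOn v s) (hp : p.Monic) (hd : p.natDegree ≤ #s) (hx : ∀ i ∈ s, x ≠ v i) :
    p.eval x = (nodal s v).eval x * ((if p.natDegree = #s then 1 else 0) +
      ∑ i ∈ s, nodalWeight s v i * (x - v i)⁻¹ * p.eval (v i)) := by
  rw [mul_add]
  split_ifs with h
  · have hdeg : p.degree = #s := by rw [degree_eq_natDegree hp.ne_zero, h]
    have hlt : (p - nodal s v).degree < #s := by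
      rw [← hdeg]
      exact degree_sub_lt_left (by rw [hdeg, degree_nodal]) hp.ne_zero
        (by rw [hp.leadingCoeff, nodal_monic.leadingCoeff])
    have := congrArg (eval x) (eq_interpolate hv hlt)
    rw [eval_interpolate_not_at_node _ hx, eval_sub] at this
    rw [mul_one, ← sub_eq_iff_eq_add', this]
    congr 1
    refine sum_congr rfl fun i hi => ?_
    rw [eval_sub, eval_nodal_at_node hi, sub_zero]
  · have hlt : p.degree < #s := by
      rw [degree_eq_natDegree hp.ne_zero]
      exact_mod_cast lt_of_le_of_ne hd h
    rw [mul_zero, zero_add, ← eval_interpolate_not_at_node _ hx, ← eq_interpolate hv hlt]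

theorem hasSum_integral_pow_mul_exp (ξ : ℝ) (l : ℕ) :
    HasSum (fun m : ℕ => ξ ^ m / m.factorial * ((m : ℝ) + l + 1)⁻¹)
      (∫ t in (0 : ℝ)..1, t ^ l * Real.exp (ξ * t)) := by
  have h := intervalIntegral.hasSum_integral_of_dominated_convergence (a := 0) (b := 1)
    (μ := MeasureTheory.volume) (F := fun (m : ℕ) (t : ℝ) => t ^ l * ((ξ * t) ^ m / m.factorial))
    (f := fun t => t ^ l * Real.exp (ξ * t)) (fun m _ => |ξ| ^ m / m.factorial)
    (fun m => by fun_prop)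
    (fun m => .of_forall fun t ht => by
      rw [Set.uIoc_of_le zero_le_one] at ht
      have h0 := ht.1.le
      rw [norm_mul, norm_div, norm_pow, norm_pow, norm_mul, Real.norm_of_nonneg h0, mul_pow,
        Real.norm_eq_abs, Real.norm_natCast]
      calc t ^ l * (|ξ| ^ m * t ^ m / m.factorial) ≤ 1 * (|ξ| ^ m * 1 / m.factorial) := by
            gcongr
            · exact pow_le_one₀ h0 ht.2
            · exact pow_le_one₀ h0 ht.2
        _ = _ := by ring)
    (.of_forall fun t _ => Real.summable_pow_div_factorial _)
    (intervalIntegrable_const)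
    (.of_forall fun t _ => by
      refine HasSum.mul_left _ ?_
      rw [Real.exp_eq_exp_ℝ]
      exact NormedSpace.expSeries_div_hasSum_exp (ξ * t))
  have : ∀ (m : ℕ) (t : ℝ),
      t ^ l * ((ξ * t) ^ m / m.factorial) = ξ ^ m / m.factorial * t ^ (m + l) :=
    fun m t => by ring
  simpa [this, integral_pow] using h

/-- `∏ (x - (2i + 1))`, the value at `1` of `(x⁻¹ D)^N` applied to the power `t^(x-1)`. -/
noncomputable def oddProd (N : ℕ) (x : ℝ) : ℝ := ∏ i ∈ range N, (x - (2 * i + 1))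

theorem ascPochhammer_eval_eq_prod (n : ℕ) (x : ℝ) :
    (ascPochhammer ℝ n).eval x = ∏ i ∈ range n, (x + i) := by
  induction n with
  | zero => simp
  | succ n ih => rw [ascPochhammer_succ_eval, ih, prod_range_succ]

theorem two_pow_mul_ascPochhammer_eval_half (N : ℕ) (x : ℝ) :
    2 ^ N * (ascPochhammer ℝ N).eval ((x + 2) / 2) = oddProd N (x + 2 * N + 1) := by
  rw [ascPochhammer_eval_eq_prod, oddProd, ← prod_range_reflect]
  conv_lhs => rw [← card_range N, ← prod_const, card_range, ← prod_mul_distrib]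
  refine prod_congr rfl fun i hi => ?_
  have hi := mem_range.1 hi
  rw [Nat.sub_sub, Nat.cast_sub (by omega)]
  push_cast; ring

open Polynomial Lagrange in
theorem oddProd_div_ascPochhammer {N M : ℕ} (h : N ≤ M) (s m : ℕ) :
    oddProd N (m + M + s) / (ascPochhammer ℝ M).eval ((m : ℝ) + 1) =
      (if N = M then 1 else 0) + ∑ l ∈ range M, (-1) ^ l / (l.factorial * (M - 1 - l).factorial) *
        ((m : ℝ) + l + 1)⁻¹ * oddProd N ((M - 1 - l + s : ℕ)) := by
  set v : ℕ → ℝ := fun l => (M : ℝ) + s - 1 - l with hv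
  have hinj : Set.InjOn v (range M) := fun a _ b _ hab => by
    simpa [hv] using hab
  have hdiff : ∀ l : ℕ, ((m : ℝ) + M + s) - v l = m + l + 1 := fun l => by simp only [hv]; ring
  have hnodal : (nodal (range M) v).eval ((m : ℝ) + M + s) =
      (ascPochhammer ℝ M).eval ((m : ℝ) + 1) := by
    rw [eval_nodal, ascPochhammer_eval_eq_prod]
    exact prod_congr rfl fun i _ => by rw [hdiff]; ring
  have hpos : 0 < (ascPochhammer ℝ M).eval ((m : ℝ) + 1) := ascPochhammer_pos _ _ (by positivity)
  have hp : (nodal (range N) fun i : ℕ => (2 * (i : ℝ) + 1)).natDegree = N := by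
    rw [natDegree_nodal, card_range]
  have key := eval_eq_nodal_mul_of_monic (p := nodal (range N) fun i : ℕ => (2 * (i : ℝ) + 1))
    (x := (m : ℝ) + M + s) hinj nodal_monic (by rw [hp, card_range]; exact h) (fun i _ hi => by
      have h1 := hdiff i
      rw [hi, sub_self] at h1
      have : (0 : ℝ) < m + i + 1 := by positivity
      exact this.ne h1)
  rw [hp, card_range, hnodal] at key
  simp only [eval_nodal] at key
  rw [div_eq_iff hpos.ne', mul_comm _ (eval _ _), oddProd, key]
  congr 2
  refine sum_congr rfl fun l hl => ?_
  have hl := mem_range.1 hl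
  obtain ⟨b, rfl⟩ : ∃ b, M = l + 1 + b := ⟨M - (l + 1), by omega⟩
  have hw : nodalWeight (range (l + 1 + b)) v l =
      (-1) ^ l / (l.factorial * b.factorial) := by
    rw [nodalWeight, prod_inv_distrib]
    have : ∏ j ∈ (range (l + 1 + b)).erase l, (v l - v j) =
        (-1) ^ l * l.factorial * b.factorial := by
      rw [← prod_erase_range_sub]
      exact prod_congr rfl fun i _ => by simp only [hv]; ring
    rw [this, mul_assoc, mul_inv, ← inv_pow, inv_neg, inv_one, div_eq_mul_inv]
  have hb : l + 1 + b - 1 - l = b := by omega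
  have hvl : v l = ((b + s : ℕ) : ℝ) := by simp only [hv]; push_cast; ring
  rw [hdiff, hw, hb, hvl, oddProd]

open Polynomial in
theorem coeff_linear_pow_mul_linear_pow_nonneg {a b c d : ℝ} (ha : 0 ≤ a) (hb : 0 ≤ b) (hc : 0 ≤ c)
    (hd : 0 ≤ d) (k P n : ℕ) :
    0 ≤ ((C a + C b * X) ^ k * (C c + C d * X) ^ P : ℝ[X]).coeff n := by
  have hmul : ∀ p q : ℝ[X], (∀ n, 0 ≤ p.coeff n) → (∀ n, 0 ≤ q.coeff n) →
      ∀ n, 0 ≤ (p * q).coeff n := fun p q hp hq n => by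
    rw [coeff_mul]
    exact sum_nonneg fun x _ => mul_nonneg (hp _) (hq _)
  have hpow : ∀ p : ℝ[X], (∀ n, 0 ≤ p.coeff n) → ∀ k n, 0 ≤ (p ^ k).coeff n := fun p hp k => by
    induction k with
    | zero =>
      intro n
      rw [pow_zero, coeff_one]
      split_ifs <;> norm_num
    | succ k ih => rw [pow_succ]; exact hmul _ _ ih hp
  have hlin : ∀ a b : ℝ, 0 ≤ a → 0 ≤ b → ∀ n, 0 ≤ (C a + C b * X : ℝ[X]).coeff n := by
    intro a b ha hb n
    rcases n with _ | _ | n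
    · simpa using ha
    · simpa using hb
    · simp
  exact hmul _ _ (hpow _ (hlin a b ha hb) k) (hpow _ (hlin c d hc hd) P) n

/-- The coefficient of `t ^ l` in the density whose Laplace transform is `bmvA`. -/
noncomputable def bmvWeight (N M k : ℕ) (v : ℝ) (l : ℕ) : ℝ :=
  ∑ j ∈ range (k + 1), (k.choose j : ℝ) * v ^ j *
    ((-1) ^ l / (l.factorial * (M - 1 - l).factorial) * oddProd N ((M - 1 - l + (k - j) : ℕ)))

open Polynomial in
theorem bmvWeight_density_nonneg {N M k : ℕ} (h : k + M = 2 * N + 1) {v t : ℝ} (hv : |v| ≤ 1)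
    (ht0 : 0 ≤ t) (ht1 : t ≤ 1) : 0 ≤ ∑ l ∈ range M, bmvWeight N M k v l * t ^ l := by
  rcases M with _ | P
  · simp
  obtain ⟨hv1, hv2⟩ := abs_le.1 hv
  have hnn := coeff_linear_pow_mul_linear_pow_nonneg (a := 1 + v) (b := 1 - v) (c := 1 - t)
    (d := 1 + t) (by linarith) (by linarith) (by linarith) (by linarith) k P N
  have hexp : ((C (1 + v) + C (1 - v) * X) ^ k * (C (1 - t) + C (1 + t) * X) ^ P : ℝ[X]) =
      ∑ l ∈ range (P + 1), ∑ j ∈ range (k + 1),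
        C (k.choose j * v ^ j * (P.choose l * (-t) ^ l)) *
          ((1 + X) ^ (P - l + (k - j)) * (1 - X) ^ (j + l)) := by
    have h1 : (C (1 + v) + C (1 - v) * X : ℝ[X]) = C v * (1 - X) + (1 + X) := by
      simp only [C_add, C_sub, C_1]; ring
    have h2 : (C (1 - t) + C (1 + t) * X : ℝ[X]) = C (-t) * (1 - X) + (1 + X) := by
      simp only [C_add, C_sub, C_neg, C_1]; ring
    rw [h1, h2, add_pow, add_pow, sum_mul_sum, sum_comm]
    refine sum_congr rfl fun l _ => sum_congr rfl fun j _ => ?_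
    simp only [C_mul, C_pow, map_natCast, mul_pow]
    ring
  have hsum : ∑ l ∈ range (P + 1), bmvWeight N (P + 1) k v l * t ^ l =
      N.factorial / (2 ^ N * P.factorial) *
        ((C (1 + v) + C (1 - v) * X) ^ k * (C (1 - t) + C (1 + t) * X) ^ P : ℝ[X]).coeff N := by
    rw [hexp, finsetSum_coeff, mul_sum]
    refine sum_congr rfl fun l hl => ?_
    have hl := mem_range.1 hl
    rw [finsetSum_coeff, mul_sum, bmvWeight, sum_mul]
    refine sum_congr rfl fun j hj => ?_
    have hj := mem_range.1 hj
    have hc := factorial_mul_coeff_one_add_mul_one_sub N (P - l + (k - j)) (j + l) (by omega)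
    have hf : ((P.choose l : ℝ) * l.factorial * (P - l).factorial) = P.factorial := by
      exact_mod_cast Nat.choose_mul_factorial_mul_factorial (by omega)
    rw [coeff_C_mul, Nat.add_sub_cancel, oddProd, ← hf]
    have hQ := eq_div_of_mul_eq (by positivity) ((mul_comm _ _).trans hc.symm)
    have hch : (P.choose l : ℝ) ≠ 0 := by exact_mod_cast (Nat.choose_pos (by omega)).ne'
    rw [hQ, neg_pow t]
    field_simp
  rw [hsum]
  exact mul_nonneg (by positivity) hnn

theorem bmvA_term_eq {k r : ℕ} (hk : 1 ≤ k) (v ξ : ℝ) (m : ℕ) :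
    ∑ j ∈ range (k + 1), (k.choose j : ℝ) * 2 ^ (k + r - 1) *
      (ascPochhammer ℝ (k + r - 1)).eval (((m : ℝ) - j + 2) / 2) /
      (ascPochhammer ℝ (k + 2 * r - 1)).eval ((m : ℝ) + 1) * v ^ j * ξ ^ m / m.factorial =
    (if k + r - 1 = k + 2 * r - 1 then 1 else 0) * (1 + v) ^ k * (ξ ^ m / m.factorial) +
      ∑ l ∈ range (k + 2 * r - 1), bmvWeight (k + r - 1) (k + 2 * r - 1) k v l *
        (ξ ^ m / m.factorial * ((m : ℝ) + l + 1)⁻¹) := by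
  have hNM : (k : ℝ) + (k + 2 * r - 1 : ℕ) = 2 * (k + r - 1 : ℕ) + 1 := by
    have : k + (k + 2 * r - 1) = 2 * (k + r - 1) + 1 := by omega
    exact_mod_cast this
  have hle : k + r - 1 ≤ k + 2 * r - 1 := by omega
  generalize k + r - 1 = N at *
  generalize k + 2 * r - 1 = M at *
  have hbin : (1 + v) ^ k = ∑ j ∈ range (k + 1), (k.choose j : ℝ) * v ^ j := by
    rw [add_comm, add_pow]
    exact sum_congr rfl fun j _ => by ring
  rw [hbin]
  simp only [bmvWeight, sum_mul, mul_sum]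
  rw [sum_comm, ← sum_add_distrib]
  refine sum_congr rfl fun j hj => ?_
  have hj := mem_range.1 hj
  have hx : (m : ℝ) - j + 2 * N + 1 = m + M + (k - j : ℕ) := by
    rw [Nat.cast_sub (by omega)]; linarith
  have h1 := two_pow_mul_ascPochhammer_eval_half N ((m : ℝ) - j)
  rw [hx] at h1
  rw [mul_assoc _ (2 ^ N), h1, mul_div_assoc _ (oddProd N _), oddProd_div_ascPochhammer hle]
  simp only [mul_add, add_mul, add_div, mul_sum, sum_mul, sum_div]
  congr 1
  · ring
  · exact sum_congr rfl fun l _ => by ring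

theorem bmvA_nonneg (k r : ℕ) (hk : 1 ≤ k) (v ξ : ℝ) (hv : |v| ≤ 1) :
    0 ≤ bmvA k r v ξ := by
  have hsum : HasSum (fun m : ℕ => ∑ j ∈ range (k + 1), (k.choose j : ℝ) * 2 ^ (k + r - 1) *
      (ascPochhammer ℝ (k + r - 1)).eval (((m : ℝ) - j + 2) / 2) /
      (ascPochhammer ℝ (k + 2 * r - 1)).eval ((m : ℝ) + 1) * v ^ j * ξ ^ m / m.factorial)
      ((if k + r - 1 = k + 2 * r - 1 then 1 else 0) * (1 + v) ^ k * Real.exp ξ +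
        ∑ l ∈ range (k + 2 * r - 1), bmvWeight (k + r - 1) (k + 2 * r - 1) k v l *
          ∫ t in (0 : ℝ)..1, t ^ l * Real.exp (ξ * t)) := by
    simp only [bmvA_term_eq hk]
    refine HasSum.add (HasSum.mul_left _ ?_)
      (hasSum_sum fun l _ => (hasSum_integral_pow_mul_exp ξ l).mul_left _)
    rw [Real.exp_eq_exp_ℝ]
    exact NormedSpace.expSeries_div_hasSum_exp ξ
  rw [bmvA, hsum.tsum_eq]
  refine add_nonneg ?_ ?_
  · have : 0 ≤ 1 + v := by linarith [(abs_le.1 hv).1]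
    split_ifs <;> positivity
  · simp only [← intervalIntegral.integral_const_mul]
    rw [← intervalIntegral.integral_finsetSum fun l _ =>
      Continuous.intervalIntegrable (by fun_prop) _ _]
    refine intervalIntegral.integral_nonneg zero_le_one fun t ht => ?_
    simp only [← mul_assoc, ← sum_mul]
    exact mul_nonneg (bmvWeight_density_nonneg (by omega) hv ht.1 ht.2) (Real.exp_pos _).le
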